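/- Let τ ≥ 0, let m and l be nonnegative integers with l ≥ m, and let h : ℂ → ℂ be an entire function of exponential type τ such that h(z) = ∑_{j=0}^∞ b_j z^{2m+2j} for all z ∈ ℂ, where b_0 ≠ 0, and such that the restriction of h to [0,∞) is real-valued and absolutely integrable, i.e. ∫_0^∞ |h(x)| dx < ∞. Then for every real λ > τ, the Hankel transform evaluates exactly to a terminating expansion: ∫_0^∞ h(x) J_{2l+1}(λx) dx = (1/2) ∑_{j=0}^{l−m} b_j · (l+m+j)!/(l−m−j)! · (2/λ)^{2m+2j+1}. -/

import Mathlib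

open MeasureTheory Real

/-- Bessel function of the first kind of nonnegative integer order `n`. -/
noncomputable def besselJ (n : ℕ) (x : ℝ) : ℝ :=
  ∑' k : ℕ, (-1 : ℝ) ^ k / (Nat.factorial k * Nat.factorial (n + k)) * (x / 2) ^ (n + 2 * k)

/-- `f` is an entire function of exponential type `τ`. -/
def ExpType (τ : ℝ) (f : ℂ → ℂ) : Prop :=
  Differentiable ℂ f ∧
    ∀ ε > 0, ∃ C > 0, ∀ z : ℂ, ‖f z‖ ≤ C * Real.exp ((τ + ε) * ‖z‖)

/-- Termwise integration over `[-π/2, π/2]` of an absolutely convergent trigonometric series whose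
frequencies are even: only the zero frequency contributes. -/
theorem hasSum_integral_even_trig_series {ι : Type*} [Countable ι] {c : ι → ℂ} {e : ι → ℤ}
    (hc : Summable fun i => ‖c i‖) (he : ∀ i, c i ≠ 0 → Even (e i)) {f : ℝ → ℂ}
    (hf : ∀ θ : ℝ, HasSum (fun i => c i * Complex.exp (e i * (θ * Complex.I))) (f θ)) :
    HasSum (fun i => if e i = 0 then (π : ℂ) * c i else 0)
      (∫ θ in (-(π / 2))..(π / 2), f θ) := by
  have key := intervalIntegral.hasSum_integral_of_dominated_convergence
    (μ := volume) (a := -(π / 2)) (b := π / 2) (f := f)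
    (F := fun i (θ : ℝ) => c i * Complex.exp (e i * (θ * Complex.I))) (fun i _ => ‖c i‖)
    (fun i => (by fun_prop : Continuous _).aestronglyMeasurable)
    (fun i => Filter.Eventually.of_forall fun θ _ => by
      have : ‖Complex.exp (e i * (θ * Complex.I))‖ = 1 := by
        have := Complex.norm_exp_ofReal_mul_I (e i * θ)
        push_cast at this
        rwa [mul_assoc] at this
      simp only [norm_mul, this, mul_one, le_refl])
    (Filter.Eventually.of_forall fun _ _ => hc) (by simp)
    (Filter.Eventually.of_forall fun θ _ => hf θ)
  convert! key using 2 with i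
  rw [intervalIntegral.integral_const_mul]
  split_ifs with h0
  · simp [h0]
    ring
  · by_cases hci : c i = 0
    · simp [hci]
    obtain ⟨k, hk⟩ := he i hci
    have hne : (e i : ℂ) * Complex.I ≠ 0 := by simp [h0]
    have : ∀ θ : ℝ, Complex.exp (e i * (θ * Complex.I)) = Complex.exp ((e i * Complex.I) * θ) := by
      intro θ; ring_nf
    simp_rw [this]
    rw [integral_exp_mul_complex hne]
    have : Complex.exp (e i * Complex.I * ((π / 2 : ℝ) : ℂ))
        = Complex.exp (e i * Complex.I * ((-(π / 2) : ℝ) : ℂ)) := by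
      rw [Complex.exp_eq_exp_iff_exists_int]
      refine ⟨k, ?_⟩
      rw [hk]; push_cast; ring
    rw [this]; simp

/-- Cauchy estimate on a circle for the coefficients of an even power series. -/
theorem norm_coeff_mul_pow_le {h : ℂ → ℂ} {b : ℕ → ℂ} {m : ℕ}
    (hexp : ∀ z : ℂ, HasSum (fun j : ℕ => b j * z ^ (2 * m + 2 * j)) (h z))
    {r M : ℝ} (hr : 0 ≤ r) (hM : ∀ z : ℂ, ‖z‖ = r → ‖h z‖ ≤ M) (j : ℕ) :
    ‖b j‖ * r ^ (2 * m + 2 * j) ≤ M := by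
  have hs : Summable fun i => ‖b i * (r : ℂ) ^ (2 * m + 2 * i)‖ := (hexp r).summable.norm
  have key := hasSum_integral_even_trig_series (c := fun i => b i * (r : ℂ) ^ (2 * m + 2 * i))
    (e := fun i => 2 * (i : ℤ) - 2 * j) hs
    (fun i _ => ⟨i - j, by ring⟩)
    (f := fun θ => h (r * Complex.exp (θ * Complex.I))
      * Complex.exp (-((2 * m + 2 * j : ℕ) * (θ * Complex.I)))) (by
      intro θ
      convert! ((hexp (r * Complex.exp (θ * Complex.I))).mul_right
        (Complex.exp (-((2 * m + 2 * j : ℕ) * (θ * Complex.I))))) using 2 with i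
      rw [mul_pow, ← Complex.exp_nat_mul, mul_assoc, mul_assoc, mul_assoc, ← Complex.exp_add]
      congr 3
      push_cast; ring)
  have key2 := hasSum_sum_of_ne_finset_zero (L := SummationFilter.unconditional ℕ)
    (f := fun i : ℕ => if 2 * (i : ℤ) - 2 * j = 0
      then (π : ℂ) * (b i * (r : ℂ) ^ (2 * m + 2 * i)) else 0) (s := {j}) (by
      intro i hi
      rw [if_neg]
      simp at hi
      omega)
  have := key.unique key2
  simp only [Finset.sum_singleton, sub_self, if_true] at this
  have hn : ‖∫ θ in (-(π / 2))..(π / 2), h (r * Complex.exp (θ * Complex.I))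
      * Complex.exp (-((2 * m + 2 * j : ℕ) * (θ * Complex.I)))‖ ≤ M * |π / 2 - -(π / 2)| := by
    apply intervalIntegral.norm_integral_le_of_norm_le_const
    intro θ _
    have h1 : ‖Complex.exp (-((2 * m + 2 * j : ℕ) * (θ * Complex.I)))‖ = 1 := by
      have := Complex.norm_exp_ofReal_mul_I (-((2 * m + 2 * j : ℕ) * θ))
      push_cast at this ⊢
      rw [← this]; congr 2; ring
    rw [norm_mul, h1, mul_one]
    apply hM
    simp [abs_of_nonneg hr]
  rw [this] at hn
  have hpi : |π / 2 - -(π / 2)| = π := by rw [abs_of_pos] <;> linarith [pi_pos]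
  rw [hpi] at hn
  simp only [norm_mul, norm_pow, Complex.norm_real, norm_eq_abs, abs_of_nonneg hr,
    abs_of_pos pi_pos] at hn
  nlinarith [pi_pos]

theorem integral_pow_mul_exp_neg (k : ℕ) {ρ : ℝ} (hρ : 0 < ρ) :
    ∫ t in Set.Ioi (0 : ℝ), t ^ k * Real.exp (-(ρ * t)) = k.factorial / ρ ^ (k + 1) := by
  have := Real.integral_rpow_mul_exp_neg_mul_Ioi (a := k + 1) (r := ρ) (by positivity) hρ
  rw [Real.Gamma_nat_eq_factorial] at this
  simp only [add_sub_cancel_right, rpow_natCast] at this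
  rw [this]
  norm_cast
  rw [div_pow]
  ring

theorem integrableOn_pow_mul_exp_neg (k : ℕ) {ρ : ℝ} (hρ : 0 < ρ) :
    IntegrableOn (fun t : ℝ => t ^ k * Real.exp (-(ρ * t))) (Set.Ioi 0) := by
  by_contra hn
  have := integral_pow_mul_exp_neg k hρ
  rw [integral_undef hn] at this
  have h2 : (0 : ℝ) < k.factorial / ρ ^ (k + 1) := by positivity
  linarith

/-- The Borel transform of an even entire function of exponential type `τ` converges absolutely
outside the disc of radius `τ`. -/
theorem summable_borel_coeff {τ : ℝ} (hτ : 0 ≤ τ) {h : ℂ → ℂ} {b : ℕ → ℂ} {m : ℕ}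
    (hgrowth : ∀ ε > 0, ∃ C > 0, ∀ z : ℂ, ‖h z‖ ≤ C * Real.exp ((τ + ε) * ‖z‖))
    (hexp : ∀ z : ℂ, HasSum (fun j : ℕ => b j * z ^ (2 * m + 2 * j)) (h z))
    {ρ : ℝ} (hρ : τ < ρ) :
    Summable fun j : ℕ => ‖b j‖ * ((2 * m + 2 * j).factorial / ρ ^ (2 * m + 2 * j + 1)) := by
  obtain ⟨σ, hσ, hσρ⟩ := exists_between hρ
  have hσ0 : 0 < σ := hτ.trans_lt hσ
  have hρ0 : 0 < ρ := hτ.trans_lt hρ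
  set ε := (σ - τ) / 2 with hε
  have hε0 : 0 < ε := by simp only [hε]; linarith
  obtain ⟨C, hC, hb⟩ := hgrowth ε hε0
  have bound : ∀ j : ℕ, ‖b j‖ * ((2 * m + 2 * j).factorial / σ ^ (2 * m + 2 * j + 1)) ≤ C / ε := by
    intro j
    have h1 : ∫ t in Set.Ioi (0 : ℝ), ‖b j‖ * (t ^ (2 * m + 2 * j) * Real.exp (-(σ * t)))
        ≤ ∫ t in Set.Ioi (0 : ℝ), C * (t ^ 0 * Real.exp (-(ε * t))) := by
      apply setIntegral_mono_on ((integrableOn_pow_mul_exp_neg _ hσ0).const_mul _)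
        ((integrableOn_pow_mul_exp_neg _ hε0).const_mul _) measurableSet_Ioi
      intro t ht
      have ht0 : (0 : ℝ) < t := ht
      have h2 := norm_coeff_mul_pow_le hexp ht0.le (M := C * Real.exp ((τ + ε) * t))
        (fun z hz => by rw [← hz]; exact hb z) j
      have h3 : Real.exp (-(ε * t)) = Real.exp ((τ + ε) * t) * Real.exp (-(σ * t)) := by
        rw [← Real.exp_add]; congr 1; simp only [hε]; ring
      rw [h3, ← mul_assoc, pow_zero, one_mul, ← mul_assoc]
      gcongr
    rw [integral_const_mul, integral_const_mul, integral_pow_mul_exp_neg _ hσ0,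
      integral_pow_mul_exp_neg _ hε0] at h1
    simpa [div_eq_mul_inv] using h1
  have hq : σ / ρ < 1 := (div_lt_one hρ0).2 hσρ
  have hq0 : 0 ≤ σ / ρ := by positivity
  have hgeo : Summable fun j : ℕ => C / ε * (σ / ρ) ^ j :=
    (summable_geometric_of_lt_one hq0 hq).mul_left _
  refine Summable.of_nonneg_of_le (fun j => by positivity) (fun j => ?_) hgeo
  calc ‖b j‖ * ((2 * m + 2 * j).factorial / ρ ^ (2 * m + 2 * j + 1))
      = ‖b j‖ * ((2 * m + 2 * j).factorial / σ ^ (2 * m + 2 * j + 1))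
        * (σ / ρ) ^ (2 * m + 2 * j + 1) := by
        rw [div_pow]; field_simp
    _ ≤ C / ε * (σ / ρ) ^ j := by
        gcongr ?_ * ?_
        · exact bound j
        · exact pow_le_pow_of_le_one hq0 hq.le (by omega)

/-- The Laplace transform `s ↦ ∫₀^∞ f(x) exp(-s x) dx`. -/
noncomputable def halfLineLaplace (f : ℝ → ℂ) (s : ℂ) : ℂ :=
  ∫ x in Set.Ioi (0 : ℝ), f x * Complex.exp (-(s * x))

theorem norm_exp_neg_mul_le_one {s : ℂ} (hs : 0 ≤ s.re) {x : ℝ} (hx : 0 ≤ x) :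
    ‖Complex.exp (-(s * x))‖ ≤ 1 := by
  rw [Complex.norm_exp, Real.exp_le_one_iff]
  simpa using mul_nonneg hs hx

theorem norm_mul_exp_neg_mul_le {f : ℝ → ℂ} {s : ℂ} (hs : 0 ≤ s.re) {x : ℝ} (hx : 0 ≤ x) :
    ‖f x * Complex.exp (-(s * x))‖ ≤ ‖f x‖ := by
  rw [norm_mul]
  exact mul_le_of_le_one_right (norm_nonneg _) (norm_exp_neg_mul_le_one hs hx)

theorem continuousOn_halfLineLaplace {f : ℝ → ℂ} (hf : IntegrableOn f (Set.Ioi 0)) :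
    ContinuousOn (halfLineLaplace f) {s | 0 ≤ s.re} := by
  apply continuousOn_of_dominated (bound := fun x => ‖f x‖)
  · intro s _
    exact hf.aestronglyMeasurable.mul (by fun_prop : Continuous _).aestronglyMeasurable
  · intro s hs
    filter_upwards [ae_restrict_mem measurableSet_Ioi] with x hx
    exact norm_mul_exp_neg_mul_le hs (le_of_lt hx)
  · exact hf.norm
  · exact Filter.Eventually.of_forall fun x => by fun_prop

theorem differentiableOn_halfLineLaplace {f : ℝ → ℂ} (hf : IntegrableOn f (Set.Ioi 0)) :
    DifferentiableOn ℂ (halfLineLaplace f) {s | 0 < s.re} := by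
  intro s₀ hs₀
  have hs₀' : 0 < s₀.re := hs₀
  have hmem : {s : ℂ | s₀.re / 2 < s.re} ∈ nhds s₀ :=
    (isOpen_lt continuous_const Complex.continuous_re).mem_nhds (by
      simp only [Set.mem_ofPred_eq]; linarith)
  have hmeas : ∀ s : ℂ, AEStronglyMeasurable (fun x : ℝ => f x * Complex.exp (-(s * x)))
      (volume.restrict (Set.Ioi 0)) := fun s =>
    hf.aestronglyMeasurable.mul (by fun_prop : Continuous _).aestronglyMeasurable
  refine (hasDerivAt_integral_of_dominated_loc_of_deriv_le (μ := volume.restrict (Set.Ioi 0))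
    (F := fun s (x : ℝ) => f x * Complex.exp (-(s * x)))
    (F' := fun s (x : ℝ) => f x * (Complex.exp (-(s * x)) * (-x)))
    (bound := fun x => ‖f x‖ * (2 / s₀.re)) hmem
    (Filter.Eventually.of_forall hmeas) ?_ ?_ ?_ (hf.norm.mul_const _)
    ?_).2.differentiableAt.differentiableWithinAt
  · refine Integrable.mono hf (hmeas s₀) ?_
    filter_upwards [ae_restrict_mem measurableSet_Ioi] with x hx
    exact norm_mul_exp_neg_mul_le hs₀'.le (le_of_lt hx)
  · exact hf.aestronglyMeasurable.mul (by fun_prop : Continuous _).aestronglyMeasurable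
  · filter_upwards [ae_restrict_mem measurableSet_Ioi] with x hx s hs
    have hx0 : (0 : ℝ) < x := hx
    have hs' : s₀.re / 2 < s.re := hs
    rw [norm_mul, norm_mul, norm_neg, Complex.norm_real, norm_of_nonneg hx0.le]
    gcongr
    rw [Complex.norm_exp]
    have h1 : (-(s * (x : ℂ))).re = -(s.re * x) := by simp
    rw [h1, Real.exp_neg, inv_mul_le_iff₀ (Real.exp_pos _), mul_div_assoc', le_div_iff₀ hs₀']
    have h2 := Real.add_one_le_exp (s.re * x)
    nlinarith
  · refine Filter.Eventually.of_forall fun x s _ => ?_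
    have h1 : HasDerivAt (fun s : ℂ => -(s * (x : ℂ))) (-(x : ℂ)) s := by
      simpa using! ((hasDerivAt_id s).mul_const (x : ℂ)).neg
    exact h1.cexp.const_mul (f x)

/-- For real `s > τ` the Laplace transform is given by the Borel series. -/
theorem hasSum_halfLineLaplace_ofReal {τ : ℝ} (hτ : 0 ≤ τ) {h : ℂ → ℂ} {b : ℕ → ℂ} {m : ℕ}
    (hgrowth : ∀ ε > 0, ∃ C > 0, ∀ z : ℂ, ‖h z‖ ≤ C * Real.exp ((τ + ε) * ‖z‖))
    (hexp : ∀ z : ℂ, HasSum (fun j : ℕ => b j * z ^ (2 * m + 2 * j)) (h z))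
    {ρ : ℝ} (hρ : τ < ρ) :
    HasSum (fun j : ℕ => b j * ((2 * m + 2 * j).factorial / (ρ : ℂ) ^ (2 * m + 2 * j + 1)))
      (halfLineLaplace (fun x => h x) ρ) := by
  have hρ0 : 0 < ρ := hτ.trans_lt hρ
  have hterm : ∀ (j : ℕ) (x : ℝ), b j * (x : ℂ) ^ (2 * m + 2 * j) * Complex.exp (-((ρ : ℂ) * x))
      = b j * ((x ^ (2 * m + 2 * j) * Real.exp (-(ρ * x)) : ℝ) : ℂ) := by
    intro j x; push_cast; ring
  have key := hasSum_integral_of_summable_integral_norm (μ := volume.restrict (Set.Ioi 0))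
    (F := fun (j : ℕ) (x : ℝ) =>
      b j * (x : ℂ) ^ (2 * m + 2 * j) * Complex.exp (-((ρ : ℂ) * x)))
    (fun j => by
      simp_rw [hterm]
      exact (integrableOn_pow_mul_exp_neg _ hρ0).ofReal.const_mul _)
    (by
      refine (summable_borel_coeff hτ hgrowth hexp hρ).congr fun j => ?_
      rw [← integral_pow_mul_exp_neg _ hρ0, ← integral_const_mul]
      refine setIntegral_congr_fun measurableSet_Ioi fun x hx => ?_
      have hx0 : (0 : ℝ) < x := hx
      simp only [hterm]
      rw [norm_mul, Complex.norm_real, norm_of_nonneg (by positivity)])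
  have hsum : ∀ x : ℝ, ∑' j : ℕ, b j * (x : ℂ) ^ (2 * m + 2 * j) * Complex.exp (-((ρ : ℂ) * x))
      = h x * Complex.exp (-((ρ : ℂ) * x)) := fun x => ((hexp x).mul_right _).tsum_eq
  simp_rw [hsum] at key
  refine key.congr_fun fun j => ?_
  simp_rw [hterm]
  rw [integral_const_mul, integral_complex_ofReal, integral_pow_mul_exp_neg _ hρ0]
  push_cast
  rfl

theorem norm_borel_term_le {b : ℕ → ℂ} {m : ℕ} {σ : ℝ} (hσ : 0 < σ) {s : ℂ} (hs : σ ≤ ‖s‖) (j : ℕ) :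
    ‖b j * ((2 * m + 2 * j).factorial / s ^ (2 * m + 2 * j + 1))‖
      ≤ ‖b j‖ * ((2 * m + 2 * j).factorial / σ ^ (2 * m + 2 * j + 1)) := by
  rw [norm_mul, norm_div, norm_pow, Complex.norm_natCast]
  gcongr

theorem differentiableOn_borel_series {τ : ℝ} (hτ : 0 ≤ τ) {h : ℂ → ℂ} {b : ℕ → ℂ} {m : ℕ}
    (hgrowth : ∀ ε > 0, ∃ C > 0, ∀ z : ℂ, ‖h z‖ ≤ C * Real.exp ((τ + ε) * ‖z‖))
    (hexp : ∀ z : ℂ, HasSum (fun j : ℕ => b j * z ^ (2 * m + 2 * j)) (h z)) :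
    DifferentiableOn ℂ (fun s : ℂ =>
      ∑' j : ℕ, b j * ((2 * m + 2 * j).factorial / s ^ (2 * m + 2 * j + 1))) {s | τ < ‖s‖} := by
  intro s hs
  obtain ⟨σ, hσ, hσs⟩ := exists_between (show τ < ‖s‖ from hs)
  have hσ0 : 0 < σ := hτ.trans_lt hσ
  have hopen : IsOpen {s : ℂ | σ < ‖s‖} := isOpen_lt continuous_const continuous_norm
  refine ((Complex.differentiableOn_tsum_of_summable_norm (summable_borel_coeff hτ hgrowth hexp hσ)
    (fun j => ?_) hopen fun j w hw => norm_borel_term_le hσ0 (le_of_lt hw) j).differentiableAt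
    (hopen.mem_nhds hσs)).differentiableWithinAt
  intro w hw
  have hw0 : w ≠ 0 := norm_pos_iff.1 (hσ0.trans hw)
  have : w ^ (2 * m + 2 * j + 1) ≠ 0 := pow_ne_zero _ hw0
  fun_prop (disch := assumption)

/-- The Laplace transform agrees with the Borel series on the part of the open right half-plane
outside the disc of radius `τ`. -/
theorem halfLineLaplace_eq_tsum_of_re_pos {τ : ℝ} (hτ : 0 ≤ τ) {h : ℂ → ℂ} {b : ℕ → ℂ} {m : ℕ}
    (hgrowth : ∀ ε > 0, ∃ C > 0, ∀ z : ℂ, ‖h z‖ ≤ C * Real.exp ((τ + ε) * ‖z‖))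
    (hexp : ∀ z : ℂ, HasSum (fun j : ℕ => b j * z ^ (2 * m + 2 * j)) (h z))
    (hint : IntegrableOn (fun x : ℝ => h x) (Set.Ioi 0)) {s₀ : ℂ} (hre : 0 < s₀.re)
    (hs₀ : τ < ‖s₀‖) :
    halfLineLaplace (fun x => h x) s₀
      = ∑' j : ℕ, b j * ((2 * m + 2 * j).factorial / s₀ ^ (2 * m + 2 * j + 1)) := by
  have hn : 0 < ‖s₀‖ := hτ.trans_lt hs₀
  let φ : ℂ → ℝ := fun s => s.re * s₀.re + s.im * s₀.im
  have hφc : Continuous φ := by fun_prop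
  have hφ : ∀ s, φ s ≤ ‖s‖ * ‖s₀‖ := by
    intro s
    have h1 := Complex.re_le_norm (s * (starRingEnd ℂ) s₀)
    rw [norm_mul, Complex.norm_conj] at h1
    simpa [φ] using h1
  have hφs₀ : φ s₀ = ‖s₀‖ * ‖s₀‖ := by
    simp only [φ, Complex.norm_mul_self_eq_normSq, Complex.normSq_apply]
  let U : Set ℂ := {s | 0 < s.re} ∩ {s | τ * ‖s₀‖ < φ s}
  have hUopen : IsOpen U := (isOpen_lt continuous_const Complex.continuous_re).inter
    (isOpen_lt continuous_const hφc)
  have hUnorm : ∀ s ∈ U, τ < ‖s‖ := fun s hs =>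
    lt_of_mul_lt_mul_right (hs.2.trans_le (hφ s)) hn.le
  have hUconv : Convex ℝ U := by
    intro x hx y hy a c ha hc hac
    obtain ⟨hx1, hx2⟩ := hx
    obtain ⟨hy1, hy2⟩ := hy
    simp only [Set.mem_ofPred_eq, φ] at hx1 hx2 hy1 hy2
    refine ⟨?_, ?_⟩
    · simp only [Set.mem_ofPred_eq, Complex.add_re, Complex.real_smul, Complex.re_ofReal_mul]
      exact convex_Ioi (0 : ℝ) hx1 hy1 ha hc hac
    · have := convex_Ioi (τ * ‖s₀‖) hx2 hy2 ha hc hac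
      simp only [Set.mem_Ioi, smul_eq_mul] at this
      simp only [Set.mem_ofPred_eq, Complex.add_re, Complex.add_im, Complex.real_smul,
        Complex.re_ofReal_mul, Complex.im_ofReal_mul, φ]
      linarith
  have hF : AnalyticOnNhd ℂ (halfLineLaplace fun x => h x) U :=
    ((differentiableOn_halfLineLaplace hint).mono fun s hs => hs.1).analyticOnNhd hUopen
  have hB : AnalyticOnNhd ℂ (fun s : ℂ =>
      ∑' j : ℕ, b j * ((2 * m + 2 * j).factorial / s ^ (2 * m + 2 * j + 1))) U :=
    ((differentiableOn_borel_series hτ hgrowth hexp).mono hUnorm).analyticOnNhd hUopen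
  have hs₀U : s₀ ∈ U := ⟨hre, by
    simp only [Set.mem_ofPred_eq, hφs₀]
    exact mul_lt_mul_of_pos_right hs₀ hn⟩
  let T : ℝ := τ + τ * ‖s₀‖ / s₀.re + 1
  have hT : τ < T := by
    have : 0 ≤ τ * ‖s₀‖ / s₀.re := by positivity
    simp only [T]; linarith
  have hTU : (T : ℂ) ∈ U := by
    refine ⟨by simpa using hτ.trans_lt hT, ?_⟩
    simp only [Set.mem_ofPred_eq, φ, Complex.ofReal_re, Complex.ofReal_im, zero_mul, add_zero]
    rw [← div_lt_iff₀ hre]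
    simp only [T]; linarith
  refine hF.eqOn_of_preconnected_of_frequently_eq hB hUconv.isPreconnected hTU ?_ hs₀U
  have htend : Filter.Tendsto (fun x : ℝ => (x : ℂ)) (nhdsWithin T {T}ᶜ)
      (nhdsWithin (T : ℂ) {(T : ℂ)}ᶜ) :=
    tendsto_nhdsWithin_of_tendsto_nhds_of_eventually_within _
      (Complex.continuous_ofReal.continuousAt.tendsto.mono_left nhdsWithin_le_nhds)
      (by filter_upwards [self_mem_nhdsWithin] with x hx; simpa using hx)
  refine htend.frequently (Filter.Eventually.frequently ?_)
  filter_upwards [nhdsWithin_le_nhds (lt_mem_nhds hT)] with x hx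
  exact (hasSum_halfLineLaplace_ofReal hτ hgrowth hexp hx).tsum_eq.symm

/-- The Laplace transform of an integrable even entire function of exponential type `τ` is given
by its Borel series on the closed right half-plane, outside the disc of radius `τ`. -/
theorem hasSum_halfLineLaplace {τ : ℝ} (hτ : 0 ≤ τ) {h : ℂ → ℂ} {b : ℕ → ℂ} {m : ℕ}
    (hgrowth : ∀ ε > 0, ∃ C > 0, ∀ z : ℂ, ‖h z‖ ≤ C * Real.exp ((τ + ε) * ‖z‖))
    (hexp : ∀ z : ℂ, HasSum (fun j : ℕ => b j * z ^ (2 * m + 2 * j)) (h z))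
    (hint : IntegrableOn (fun x : ℝ => h x) (Set.Ioi 0)) {s : ℂ} (hre : 0 ≤ s.re)
    (hs : τ < ‖s‖) :
    HasSum (fun j : ℕ => b j * ((2 * m + 2 * j).factorial / s ^ (2 * m + 2 * j + 1)))
      (halfLineLaplace (fun x => h x) s) := by
  have hsummable : Summable fun j : ℕ =>
      b j * ((2 * m + 2 * j).factorial / s ^ (2 * m + 2 * j + 1)) :=
    Summable.of_norm_bounded (summable_borel_coeff hτ hgrowth hexp hs)
      fun j => norm_borel_term_le (hτ.trans_lt hs) le_rfl j
  suffices halfLineLaplace (fun x => h x) s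
      = ∑' j : ℕ, b j * ((2 * m + 2 * j).factorial / s ^ (2 * m + 2 * j + 1)) by
    rw [this]; exact hsummable.hasSum
  have hopen : IsOpen {s : ℂ | τ < ‖s‖} := isOpen_lt continuous_const continuous_norm
  have hpath : Filter.Tendsto (fun ε : ℝ => s + ε) (nhdsWithin 0 (Set.Ioi 0)) (nhds s) := by
    have : ContinuousAt (fun ε : ℝ => s + (ε : ℂ)) 0 := by fun_prop
    simpa using this.tendsto.mono_left (nhdsWithin_le_nhds (s := Set.Ioi 0))
  have hpath' : Filter.Tendsto (fun ε : ℝ => s + ε) (nhdsWithin 0 (Set.Ioi 0))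
      (nhdsWithin s {s | 0 ≤ s.re}) := by
    refine tendsto_nhdsWithin_of_tendsto_nhds_of_eventually_within _ hpath ?_
    filter_upwards [self_mem_nhdsWithin] with ε hε
    have : (0 : ℝ) < ε := hε
    simp only [Complex.add_re, Complex.ofReal_re]
    linarith
  have h1 := ((continuousOn_halfLineLaplace hint) s hre).tendsto.comp hpath'
  have h2 := (((differentiableOn_borel_series hτ hgrowth hexp).differentiableAt
    (hopen.mem_nhds hs)).continuousAt.tendsto).comp hpath
  refine tendsto_nhds_unique (h1.congr' ?_) h2
  filter_upwards [self_mem_nhdsWithin, hpath.eventually (hopen.mem_nhds hs)] with ε hε hn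
  have : (0 : ℝ) < ε := hε
  refine halfLineLaplace_eq_tsum_of_re_pos hτ hgrowth hexp hint ?_ hn
  simp only [Complex.add_re, Complex.ofReal_re]
  linarith

theorem hasSum_exp_mul_exp (z w : ℂ) : HasSum (fun p : ℕ × ℕ => z ^ p.1 / p.1.factorial *
    (w ^ p.2 / p.2.factorial)) (Complex.exp z * Complex.exp w) := by
  have hexp (z : ℂ) : HasSum (fun j : ℕ => z ^ j / j.factorial) (Complex.exp z) := by
    rw [Complex.exp_eq_exp_ℂ]; exact NormedSpace.expSeries_div_hasSum_exp z
  have hs : Summable fun p : ℕ × ℕ => z ^ p.1 / p.1.factorial * (w ^ p.2 / p.2.factorial) :=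
    summable_mul_of_summable_norm (f := fun j : ℕ => z ^ j / j.factorial)
      (g := fun j : ℕ => w ^ j / j.factorial) (hexp z).summable.norm (hexp w).summable.norm
  exact HasSum.mul (f := fun j : ℕ => z ^ j / j.factorial)
    (g := fun j : ℕ => w ^ j / j.factorial) (hexp z) (hexp w) hs

theorem hasSum_sinh_generating (n : ℕ) (y : ℝ) (θ : ℝ) :
    HasSum (fun p : ℕ × ℕ => (((-1) ^ p.1 - (-1) ^ p.2) *
      ((y / 2 : ℂ) ^ p.1 / p.1.factorial * ((y / 2) ^ p.2 / p.2.factorial)) : ℂ)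
        * Complex.exp (((p.1 : ℤ) - p.2 + n : ℤ) * (θ * Complex.I)))
      ((Complex.exp (-(Complex.sinh (θ * Complex.I) * y))
        - Complex.exp (Complex.sinh (θ * Complex.I) * y)) * Complex.exp (n * (θ * Complex.I))) := by
  have h1 := ((hasSum_exp_mul_exp (-(y / 2 * Complex.exp (θ * Complex.I)))
      (y / 2 * Complex.exp (-(θ * Complex.I)))).sub
    (hasSum_exp_mul_exp (y / 2 * Complex.exp (θ * Complex.I))
      (-(y / 2 * Complex.exp (-(θ * Complex.I)))))).mul_right
      (Complex.exp (n * (θ * Complex.I)))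
  have h2 : (Complex.exp (-(Complex.sinh (θ * Complex.I) * y))
        - Complex.exp (Complex.sinh (θ * Complex.I) * y)) * Complex.exp (n * (θ * Complex.I)) = (Complex.exp (-(y / 2 * Complex.exp (θ * Complex.I)))
        * Complex.exp (y / 2 * Complex.exp (-(θ * Complex.I)))
      - Complex.exp (y / 2 * Complex.exp (θ * Complex.I))
        * Complex.exp (-(y / 2 * Complex.exp (-(θ * Complex.I)))))
      * Complex.exp (n * (θ * Complex.I)) := by
    simp only [← Complex.exp_add, Complex.sinh]
    congr 3 <;> ring_nf
  rw [h2]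
  refine h1.congr_fun fun p => ?_
  have h3 : Complex.exp ((((p.1 : ℤ) - p.2 + n : ℤ) : ℂ) * (θ * Complex.I))
      = Complex.exp (θ * Complex.I) ^ p.1 * Complex.exp (-(θ * Complex.I)) ^ p.2
        * Complex.exp (n * (θ * Complex.I)) := by
    rw [← Complex.exp_nat_mul, ← Complex.exp_nat_mul, ← Complex.exp_add, ← Complex.exp_add]
    congr 1; push_cast; ring
  rw [h3, neg_pow, neg_pow (_ * Complex.exp (-(θ * Complex.I))) p.2, mul_pow, mul_pow]
  generalize (y / 2 : ℂ) = u
  ring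

theorem integral_sinh_generating (l : ℕ) (y : ℝ) :
    ∫ θ in (-(π / 2))..(π / 2), (Complex.exp (-(Complex.sinh (θ * Complex.I) * y))
        - Complex.exp (Complex.sinh (θ * Complex.I) * y))
        * Complex.exp ((2 * l + 1 : ℕ) * (θ * Complex.I))
      = 2 * (π * (besselJ (2 * l + 1) y : ℂ)) := by
  set n := 2 * l + 1 with hn
  have key := hasSum_integral_even_trig_series
    (c := fun p : ℕ × ℕ => (((-1) ^ p.1 - (-1) ^ p.2) *
      ((y / 2 : ℂ) ^ p.1 / p.1.factorial * ((y / 2) ^ p.2 / p.2.factorial)) : ℂ))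
    (e := fun p => (p.1 : ℤ) - p.2 + n) 
    (by
      refine Summable.norm ?_
      refine ((hasSum_exp_mul_exp (-(y / 2)) (y / 2)).summable.sub
        (hasSum_exp_mul_exp (y / 2) (-(y / 2))).summable).congr fun p => ?_
      rw [neg_pow, neg_pow (y / 2 : ℂ) p.2]
      ring)
    (by
      rintro ⟨j, k⟩ hc
      have hne : ((-1) ^ j - (-1) ^ k : ℂ) ≠ 0 := left_ne_zero_of_mul hc
      simp only [hn]
      rcases Nat.even_or_odd j with hj | hj <;> rcases Nat.even_or_odd k with hk | hk
      · simp [hj.neg_one_pow, hk.neg_one_pow] at hne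
      · obtain ⟨u, rfl⟩ := hj
        obtain ⟨v, rfl⟩ := hk
        exact ⟨u - v + l, by push_cast; ring⟩
      · obtain ⟨u, rfl⟩ := hj
        obtain ⟨v, rfl⟩ := hk
        exact ⟨u - v + l + 1, by push_cast; ring⟩
      · simp [hj.neg_one_pow, hk.neg_one_pow] at hne)
    (hasSum_sinh_generating n y)
  have hinj : Function.Injective fun j : ℕ => (j, j + n) := fun i j hij => (Prod.ext_iff.1 hij).1
  rw [← hinj.hasSum_iff (by
    rintro ⟨j, k⟩ hp
    rw [if_neg]
    intro h0
    exact hp ⟨j, Prod.ext rfl (by simp only at h0 ⊢; omega)⟩)] at key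
  rw [← key.tsum_eq, besselJ, Complex.ofReal_tsum, ← tsum_mul_left, ← tsum_mul_left]
  refine tsum_congr fun k => ?_
  have hodd : ((-1 : ℂ)) ^ (k + n) = -(-1) ^ k := by
    rw [hn, pow_add, (odd_two_mul_add_one l).neg_one_pow]; ring
  simp only [Function.comp_apply]
  rw [if_pos (by push_cast; ring), hodd, add_comm k n]
  push_cast
  rw [show n + 2 * k = k + (n + k) by ring, pow_add]
  field_simp
  ring

/-- Bessel's integral for odd order, folded to `[-π/2, π/2]` and written with `sinh (θ I)`. -/
theorem integral_exp_sinh_mul_sinh (l : ℕ) (y : ℝ) :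
    ∫ θ in (-(π / 2))..(π / 2), Complex.exp (-(Complex.sinh (θ * Complex.I) * y))
        * Complex.sinh ((2 * l + 1 : ℕ) * (θ * Complex.I))
      = π * (besselJ (2 * l + 1) y : ℂ) := by
  set n := 2 * l + 1
  let g : ℝ → ℂ := fun θ => (Complex.exp (-(Complex.sinh (θ * Complex.I) * y))
    - Complex.exp (Complex.sinh (θ * Complex.I) * y)) * Complex.exp (n * (θ * Complex.I))
  have hJ : ∫ θ in (-(π / 2))..(π / 2), g θ = 2 * (π * (besselJ n y : ℂ)) :=
    integral_sinh_generating l y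
  have hcont (σ : ℂ) (a : ℂ) : IntervalIntegrable
      (fun θ : ℝ => Complex.exp (σ * (Complex.sinh (θ * Complex.I) * y))
        * Complex.exp (a * (θ * Complex.I))) volume (-(π / 2)) (π / 2) :=
    (by fun_prop : Continuous _).intervalIntegrable _ _
  have hcont' (a : ℂ) : IntervalIntegrable
      (fun θ : ℝ => Complex.exp (-(Complex.sinh (θ * Complex.I) * y))
        * Complex.exp (a * (θ * Complex.I))) volume (-(π / 2)) (π / 2) := by
    simpa using hcont (-1) a
  have hflip : ∫ θ in (-(π / 2))..(π / 2), Complex.exp (-(Complex.sinh (θ * Complex.I) * y))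
        * Complex.exp (-n * (θ * Complex.I))
      = ∫ θ in (-(π / 2))..(π / 2), Complex.exp (Complex.sinh (θ * Complex.I) * y)
        * Complex.exp (n * (θ * Complex.I)) := by
    have := intervalIntegral.integral_comp_neg (a := -(π / 2)) (b := π / 2)
      (fun θ : ℝ => Complex.exp (Complex.sinh (θ * Complex.I) * y)
        * Complex.exp (n * (θ * Complex.I)))
    rw [neg_neg] at this
    rw [← this]
    refine intervalIntegral.integral_congr fun θ _ => ?_
    simp
  have hg : ∫ θ in (-(π / 2))..(π / 2), g θ
      = (∫ θ in (-(π / 2))..(π / 2), Complex.exp (-(Complex.sinh (θ * Complex.I) * y))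
          * Complex.exp (n * (θ * Complex.I)))
        - ∫ θ in (-(π / 2))..(π / 2), Complex.exp (-(Complex.sinh (θ * Complex.I) * y))
          * Complex.exp (-n * (θ * Complex.I)) := by
    rw [hflip, ← intervalIntegral.integral_sub (hcont' n) (by simpa using hcont 1 n)]
    simp only [g, sub_mul]
  have hsplit : ∫ θ in (-(π / 2))..(π / 2), Complex.exp (-(Complex.sinh (θ * Complex.I) * y))
        * Complex.sinh (n * (θ * Complex.I))
      = 1 / 2 * ∫ θ in (-(π / 2))..(π / 2), g θ := by
    rw [hg, ← intervalIntegral.integral_sub (hcont' n) (hcont' (-n)),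
      ← intervalIntegral.integral_const_mul]
    refine intervalIntegral.integral_congr fun θ _ => ?_
    simp only [Complex.sinh, neg_mul]
    ring
  rw [hsplit, hJ]
  ring

theorem sinh_re_eq (z : ℂ) : (Complex.sinh z).re = Real.sinh z.re * Real.cos z.im := by
  conv_lhs => rw [← Complex.re_add_im z]
  rw [Complex.sinh_add, Complex.sinh_mul_I, Complex.cosh_mul_I]
  simp [← Complex.ofReal_sinh, ← Complex.ofReal_cosh, ← Complex.ofReal_sin, ← Complex.ofReal_cos]

theorem sinh_im_eq (z : ℂ) : (Complex.sinh z).im = Real.cosh z.re * Real.sin z.im := by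
  conv_lhs => rw [← Complex.re_add_im z]
  rw [Complex.sinh_add, Complex.sinh_mul_I, Complex.cosh_mul_I]
  simp [← Complex.ofReal_sinh, ← Complex.ofReal_cosh, ← Complex.ofReal_sin, ← Complex.ofReal_cos]

theorem sinh_re_le_norm_sinh (z : ℂ) : Real.sinh z.re ≤ ‖Complex.sinh z‖ := by
  refine le_of_sq_le_sq ?_ (norm_nonneg _)
  rw [Complex.sq_norm, Complex.normSq_apply, sinh_re_eq, sinh_im_eq]
  nlinarith [Real.sin_sq_add_cos_sq z.im, Real.cosh_sq z.re, sq_nonneg (Real.sin z.im)]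

theorem hasSum_choose_mul_pow_of_one_sub_eq {𝕜 : Type*} [NormedField 𝕜] (k : ℕ) {w s c : 𝕜}
    (hw : ‖w‖ < 1) (hc : c ≠ 0) (h : 1 - w = s * c) :
    HasSum (fun p : ℕ => c ^ (k + 1) * ((p + k).choose k * w ^ p)) (1 / s ^ (k + 1)) := by
  have h1 := (hasSum_choose_mul_geometric_of_norm_lt_one k hw).mul_left (c ^ (k + 1))
  have h2 : c ^ (k + 1) * (1 / (1 - w) ^ (k + 1)) = 1 / s ^ (k + 1) := by
    rw [h, mul_pow, mul_one_div, div_mul_cancel_right₀ (pow_ne_zero _ hc), one_div]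
  rwa [h2] at h1

/-- Termwise integration of the Borel series along a vertical segment, against `exp (a ζ)`. -/
theorem hasSum_integral_halfLineLaplace_sinh_mul_exp {τ : ℝ} (hτ : 0 ≤ τ) {h : ℂ → ℂ} {b : ℕ → ℂ}
    {m : ℕ} (hgrowth : ∀ ε > 0, ∃ C > 0, ∀ z : ℂ, ‖h z‖ ≤ C * Real.exp ((τ + ε) * ‖z‖))
    (hexp : ∀ z : ℂ, HasSum (fun j : ℕ => b j * z ^ (2 * m + 2 * j)) (h z))
    (hint : IntegrableOn (fun x : ℝ => h x) (Set.Ioi 0)) {lam R : ℝ} (hlam : 0 < lam) (hR : 0 < R)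
    (hlamR : τ < lam * Real.sinh R) {f : ℝ → ℂ} {a : ℤ} (ha : Odd a)
    (hf : ∀ θ ∈ Set.uIcc (-(π / 2)) (π / 2), f θ
      = halfLineLaplace (fun x => h x) (lam * Complex.sinh (R + θ * Complex.I))
        * Complex.exp (a * (R + θ * Complex.I))) :
    HasSum (fun p : ℕ × ℕ => if a - (2 * m + 2 * p.1 + 1 + 2 * p.2 : ℕ) = 0 then
        (π : ℂ) * (b p.1 * (2 / lam) ^ (2 * m + 2 * p.1 + 1)
          * ((2 * m + 2 * p.1).factorial * (p.2 + (2 * m + 2 * p.1)).choose (2 * m + 2 * p.1)))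
      else 0)
      (∫ θ in (-(π / 2))..(π / 2), f θ) := by
  set q : ℝ := Real.exp (-R) with hq
  have hq0 : 0 < q := Real.exp_pos _
  have hq1 : ‖q ^ 2‖ < 1 := by
    rw [norm_of_nonneg (by positivity)]
    have : q < 1 := by rw [hq, Real.exp_lt_one_iff]; linarith
    nlinarith
  have hsinh0 : 0 < Real.sinh R := Real.sinh_pos_iff.2 hR
  let k : ℕ → ℕ := fun j => 2 * m + 2 * j
  let r : ℕ × ℕ → ℝ := fun p => (2 / lam * q) ^ (k p.1 + 1) * (k p.1).factorial
    * (((p.2 + k p.1).choose (k p.1)) * (q ^ 2) ^ p.2) * Real.exp (a * R)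
  have hr0 : ∀ p, 0 ≤ r p := fun p => by positivity
  have hnorm : ∀ p : ℕ × ℕ, ‖b p.1 * (r p : ℂ)‖ = ‖b p.1‖ * r p := fun p => by
    rw [norm_mul, Complex.norm_real, norm_of_nonneg (hr0 p)]
  have hqs : 1 - q ^ 2 = (lam * Real.sinh R) * (2 / lam * q) := by
    have h1 : Real.exp R * q = 1 := by rw [hq, ← Real.exp_add]; simp
    rw [Real.sinh_eq, ← hq]
    field_simp
    linear_combination -h1
  have hinner : ∀ j, HasSum (fun p => ‖b j‖ * r (j, p))
      (‖b j‖ * ((k j).factorial / (lam * Real.sinh R) ^ (k j + 1)) * Real.exp (a * R)) := by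
    intro j
    have h1 := ((hasSum_choose_mul_pow_of_one_sub_eq (k j) hq1 (by positivity) hqs).mul_left
      (‖b j‖ * (k j).factorial)).mul_right (Real.exp (a * R))
    rw [mul_one_div, mul_div_assoc] at h1
    refine h1.congr_fun fun p => ?_
    simp only [r]
    ring
  have hsum : Summable fun p : ℕ × ℕ => ‖b p.1 * (r p : ℂ)‖ := by
    simp_rw [hnorm]
    rw [summable_prod_of_nonneg (fun p => mul_nonneg (norm_nonneg _) (hr0 p))]
    refine ⟨fun j => (hinner j).summable, ?_⟩
    simp_rw [fun j => (hinner j).tsum_eq]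
    exact (summable_borel_coeff hτ hgrowth hexp hlamR).mul_right _
  let g : ℝ → ℂ := fun θ => ∑' p : ℕ × ℕ, b p.1 * (r p : ℂ)
    * Complex.exp ((a - (2 * m + 2 * p.1 + 1 + 2 * p.2 : ℕ) : ℤ) * (θ * Complex.I))
  have hg : ∀ θ : ℝ, HasSum (fun p : ℕ × ℕ => b p.1 * (r p : ℂ)
      * Complex.exp ((a - (2 * m + 2 * p.1 + 1 + 2 * p.2 : ℕ) : ℤ) * (θ * Complex.I))) (g θ) := by
    intro θ
    refine (Summable.of_norm_bounded hsum fun p => ?_).hasSum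
    have h1 := Complex.norm_exp_ofReal_mul_I ((a - (2 * m + 2 * p.1 + 1 + 2 * p.2 : ℕ) : ℤ) * θ)
    rw [Complex.ofReal_mul, Complex.ofReal_intCast, mul_assoc] at h1
    rw [norm_mul _ (Complex.exp _), h1, mul_one]
  have key := hasSum_integral_even_trig_series
    (c := fun p : ℕ × ℕ => b p.1 * (r p : ℂ)) (f := g)
    (e := fun p => a - (2 * m + 2 * p.1 + 1 + 2 * p.2 : ℕ)) hsum
    (fun p _ => by
      obtain ⟨u, rfl⟩ := ha
      exact ⟨u - m - p.1 - p.2, by push_cast; ring⟩) hg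
  have hfg : ∀ θ ∈ Set.uIcc (-(π / 2)) (π / 2), f θ = g θ := by
    intro θ hθ
    rw [hf θ hθ]
    rw [Set.uIcc_of_le (by linarith [pi_pos])] at hθ
    set ζ : ℂ := R + θ * Complex.I with hζ
    have hζre : ζ.re = R := by simp [hζ]
    have hζim : ζ.im = θ := by simp [hζ]
    have hnorm' : τ < ‖(lam : ℂ) * Complex.sinh ζ‖ := by
      rw [norm_mul, Complex.norm_real, norm_of_nonneg hlam.le]
      have := sinh_re_le_norm_sinh ζ
      rw [hζre] at this
      exact hlamR.trans_le (mul_le_mul_of_nonneg_left this hlam.le)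
    have hre : 0 ≤ ((lam : ℂ) * Complex.sinh ζ).re := by
      rw [Complex.re_ofReal_mul, sinh_re_eq, hζre, hζim]
      exact mul_nonneg hlam.le (mul_nonneg hsinh0.le (Real.cos_nonneg_of_mem_Icc hθ))
    have hB := (hasSum_halfLineLaplace hτ hgrowth hexp hint hre hnorm').mul_right
      (Complex.exp (a * ζ))
    set w := Complex.exp (-ζ) with hw
    have hwq : ‖w ^ 2‖ < 1 := by
      have : ‖w‖ = q := by rw [hw, Complex.norm_exp, Complex.neg_re, hζre]
      rwa [norm_pow, this, ← norm_of_nonneg hq0.le, ← norm_pow]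
    have hlam0 : (lam : ℂ) ≠ 0 := by exact_mod_cast hlam.ne'
    have hw0 : w ≠ 0 := Complex.exp_ne_zero _
    have hws : 1 - w ^ 2 = (lam * Complex.sinh ζ) * (2 / lam * w) := by
      have h1 : Complex.exp ζ * w = 1 := by rw [hw, ← Complex.exp_add]; simp
      rw [Complex.sinh, ← hw]
      field_simp
      linear_combination -h1
    refine hB.unique (HasSum.prod_fiberwise (f := fun p : ℕ × ℕ => b p.1 * (r p : ℂ)
      * Complex.exp ((a - (2 * m + 2 * p.1 + 1 + 2 * p.2 : ℕ) : ℤ) * (θ * Complex.I)))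
      (hg θ) fun j => ?_)
    have h1 := ((hasSum_choose_mul_pow_of_one_sub_eq (k j) hwq
      (mul_ne_zero (div_ne_zero two_ne_zero hlam0) hw0) hws).mul_left
        (b j * (k j).factorial)).mul_right (Complex.exp (a * ζ))
    rw [mul_one_div, mul_div_assoc] at h1
    refine h1.congr_fun fun p => ?_
    have h3 : Complex.exp ((a - (2 * m + 2 * j + 1 + 2 * p : ℕ) : ℤ) * (θ * Complex.I))
        * ((q : ℂ) ^ (k j + 1) * ((q : ℂ) ^ 2) ^ p * Complex.exp (a * R))
        = w ^ (k j + 1) * (w ^ 2) ^ p * Complex.exp (a * ζ) := by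
      simp only [hw, hq, hζ, k, Complex.ofReal_exp, ← Complex.exp_nat_mul, ← Complex.exp_add]
      congr 1
      push_cast
      ring
    simp only [r]
    push_cast
    push_cast at h3
    rw [mul_pow, mul_pow]
    linear_combination (b j * (2 / lam) ^ (k j + 1) * (k j).factorial
      * (p + k j).choose (k j)) * h3
  rw [intervalIntegral.integral_congr hfg]
  refine key.congr_fun fun p => ?_
  split_ifs with h0
  · have hexp1 : q ^ (k p.1 + 1) * (q ^ 2) ^ p.2 * Real.exp (a * R) = 1 := by
      have ha' : a = (2 * m + 2 * p.1 + 1 + 2 * p.2 : ℕ) := by omega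
      rw [ha', hq]
      simp only [k, ← Real.exp_nat_mul, ← Real.exp_add]
      rw [Real.exp_eq_one_iff]
      push_cast
      ring
    have hr : r p = (2 / lam) ^ (k p.1 + 1)
        * ((k p.1).factorial * (p.2 + k p.1).choose (k p.1)) := by
      simp only [r]
      rw [mul_pow]
      linear_combination ((2 / lam) ^ (k p.1 + 1)
        * ((k p.1).factorial * (p.2 + k p.1).choose (k p.1))) * hexp1
    rw [hr]
    simp only [k]
    push_cast
    ring
  · rfl

/-- On the far vertical edge the contour integral is a terminating sum. -/
theorem integral_halfLineLaplace_sinh_mul_sinh {τ : ℝ} (hτ : 0 ≤ τ) {h : ℂ → ℂ} {b : ℕ → ℂ}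
    {m l : ℕ} (hl : m ≤ l)
    (hgrowth : ∀ ε > 0, ∃ C > 0, ∀ z : ℂ, ‖h z‖ ≤ C * Real.exp ((τ + ε) * ‖z‖))
    (hexp : ∀ z : ℂ, HasSum (fun j : ℕ => b j * z ^ (2 * m + 2 * j)) (h z))
    (hint : IntegrableOn (fun x : ℝ => h x) (Set.Ioi 0)) {lam R : ℝ} (hlam : 0 < lam) (hR : 0 < R)
    (hlamR : τ < lam * Real.sinh R) :
    ∫ θ in (-(π / 2))..(π / 2),
        halfLineLaplace (fun x => h x) (lam * Complex.sinh (R + θ * Complex.I))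
          * Complex.sinh ((2 * l + 1 : ℕ) * (R + θ * Complex.I))
      = π * ((1 / 2) * ∑ j ∈ Finset.range (l - m + 1),
          b j * ((Nat.factorial (l + m + j) : ℂ) / (Nat.factorial (l - m - j) : ℂ))
            * (2 / (lam : ℂ)) ^ (2 * m + 2 * j + 1)) := by
  have hpos := hasSum_integral_halfLineLaplace_sinh_mul_exp hτ hgrowth hexp hint hlam hR hlamR
    (a := 2 * l + 1) (odd_two_mul_add_one _) (fun θ _ => rfl)
  have hneg := hasSum_integral_halfLineLaplace_sinh_mul_exp hτ hgrowth hexp hint hlam hR hlamR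
    (a := -(2 * l + 1)) (odd_two_mul_add_one _).neg (fun θ _ => rfl)
  have hneg0 := hneg.unique (hasSum_zero.congr_fun fun p => if_neg (by omega))
  have hinj : Function.Injective fun j : ℕ => (j, l - m - j) :=
    fun i j hij => (Prod.ext_iff.1 hij).1
  have hfin := hpos.unique (hasSum_sum_of_ne_finset_zero
    (s := (Finset.range (l - m + 1)).image fun j => (j, l - m - j)) (by
      rintro ⟨j, p⟩ hp
      rw [if_neg]
      intro h0
      apply hp
      simp only [Finset.mem_image, Finset.mem_range, Prod.mk.injEq]
      simp only at h0
      exact ⟨j, by omega, rfl, by omega⟩))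
  rw [Finset.sum_image hinj.injOn] at hfin
  have hcont (a : ℤ) : IntervalIntegrable (fun θ : ℝ =>
      halfLineLaplace (fun x => h x) (lam * Complex.sinh (R + θ * Complex.I))
        * Complex.exp (a * (R + θ * Complex.I))) volume (-(π / 2)) (π / 2) := by
    apply ContinuousOn.intervalIntegrable
    refine ContinuousOn.mul ?_ (by fun_prop)
    refine (continuousOn_halfLineLaplace hint).comp (by fun_prop) fun θ hθ => ?_
    rw [Set.uIcc_of_le (by linarith [pi_pos])] at hθ
    have : 0 ≤ Real.sinh R * Real.cos θ :=
      mul_nonneg (Real.sinh_nonneg_iff.2 hR.le) (Real.cos_nonneg_of_mem_Icc hθ)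
    rw [Set.mem_ofPred_eq, Complex.re_ofReal_mul, sinh_re_eq]
    simpa using mul_nonneg hlam.le this
  have hsplit : ∫ θ in (-(π / 2))..(π / 2),
        halfLineLaplace (fun x => h x) (lam * Complex.sinh (R + θ * Complex.I))
          * Complex.sinh ((2 * l + 1 : ℕ) * (R + θ * Complex.I))
      = 1 / 2 * ((∫ θ in (-(π / 2))..(π / 2),
          halfLineLaplace (fun x => h x) (lam * Complex.sinh (R + θ * Complex.I))
            * Complex.exp ((2 * l + 1 : ℤ) * (R + θ * Complex.I)))
        - ∫ θ in (-(π / 2))..(π / 2),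
          halfLineLaplace (fun x => h x) (lam * Complex.sinh (R + θ * Complex.I))
            * Complex.exp ((-(2 * l + 1) : ℤ) * (R + θ * Complex.I))) := by
    rw [← intervalIntegral.integral_sub (hcont _) (hcont _), ← intervalIntegral.integral_const_mul]
    refine intervalIntegral.integral_congr fun θ _ => ?_
    simp only [Complex.sinh]
    push_cast
    ring_nf
  rw [hsplit, hneg0, hfin, Finset.mul_sum, Finset.mul_sum, sub_zero, Finset.mul_sum]
  refine Finset.sum_congr rfl fun j hj => ?_
  have hj' : j ≤ l - m := Nat.lt_succ_iff.1 (Finset.mem_range.1 hj)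
  rw [if_pos (by simp only; omega)]
  have hfact : ((2 * m + 2 * j).factorial : ℂ)
      * (l - m - j + (2 * m + 2 * j)).choose (2 * m + 2 * j)
      = (Nat.factorial (l + m + j) : ℂ) / (Nat.factorial (l - m - j) : ℂ) := by
    rw [eq_div_iff (by exact_mod_cast Nat.factorial_ne_zero _)]
    have h1 := Nat.add_choose_mul_factorial_mul_factorial (l - m - j) (2 * m + 2 * j)
    rw [show l - m - j + (2 * m + 2 * j) = l + m + j by omega] at h1 ⊢
    rw [← h1]
    push_cast
    ring
  simp only [hfact]
  ring

/-- On the imaginary axis outside `[-τ, τ]` the Laplace transform is odd. -/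
theorem halfLineLaplace_neg_of_re_eq_zero {τ : ℝ} (hτ : 0 ≤ τ) {h : ℂ → ℂ} {b : ℕ → ℂ} {m : ℕ}
    (hgrowth : ∀ ε > 0, ∃ C > 0, ∀ z : ℂ, ‖h z‖ ≤ C * Real.exp ((τ + ε) * ‖z‖))
    (hexp : ∀ z : ℂ, HasSum (fun j : ℕ => b j * z ^ (2 * m + 2 * j)) (h z))
    (hint : IntegrableOn (fun x : ℝ => h x) (Set.Ioi 0)) {s : ℂ} (hre : s.re = 0) (hs : τ < ‖s‖) :
    halfLineLaplace (fun x => h x) (-s) = -halfLineLaplace (fun x => h x) s := by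
  have h1 := hasSum_halfLineLaplace hτ hgrowth hexp hint (s := -s) (by simp [hre])
    (by rwa [norm_neg])
  refine h1.unique ((hasSum_halfLineLaplace hτ hgrowth hexp hint hre.ge hs).neg.congr_fun
    fun j => ?_)
  have hodd : Odd (2 * m + 2 * j + 1) := ⟨m + j, by ring⟩
  rw [hodd.neg_pow, div_neg, mul_neg]

/-- Shifting the contour from `Re ζ = 0` to `Re ζ = R` in the strip `|Im ζ| ≤ π / 2`. -/
theorem integral_halfLineLaplace_sinh_shift {τ : ℝ} (hτ : 0 ≤ τ) {h : ℂ → ℂ} {b : ℕ → ℂ}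
    {m : ℕ} (l : ℕ)
    (hgrowth : ∀ ε > 0, ∃ C > 0, ∀ z : ℂ, ‖h z‖ ≤ C * Real.exp ((τ + ε) * ‖z‖))
    (hexp : ∀ z : ℂ, HasSum (fun j : ℕ => b j * z ^ (2 * m + 2 * j)) (h z))
    (hint : IntegrableOn (fun x : ℝ => h x) (Set.Ioi 0)) {lam R : ℝ} (hlam : τ < lam)
    (hR : 0 < R) :
    ∫ θ in (-(π / 2))..(π / 2),
        halfLineLaplace (fun x => h x) (lam * Complex.sinh (R + θ * Complex.I))
          * Complex.sinh ((2 * l + 1 : ℕ) * (R + θ * Complex.I))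
      = ∫ θ in (-(π / 2))..(π / 2),
        halfLineLaplace (fun x => h x) (lam * Complex.sinh (θ * Complex.I))
          * Complex.sinh ((2 * l + 1 : ℕ) * (θ * Complex.I)) := by
  have hlam0 : 0 < lam := hτ.trans_lt hlam
  have hpi : -(π / 2) ≤ π / 2 := by linarith [pi_pos]
  let Φ : ℂ → ℂ := fun ζ => halfLineLaplace (fun x => h x) (lam * Complex.sinh ζ)
    * Complex.sinh ((2 * l + 1 : ℕ) * ζ)
  have hre (ζ : ℂ) : ((lam : ℂ) * Complex.sinh ζ).re
      = lam * (Real.sinh ζ.re * Real.cos ζ.im) := by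
    rw [Complex.re_ofReal_mul, sinh_re_eq]
  have hrect := Complex.integral_boundary_rect_eq_zero_of_continuousOn_of_differentiableOn Φ
    ⟨0, -(π / 2)⟩ ⟨R, π / 2⟩
    (by
      simp only [Set.uIcc_of_le hR.le, Set.uIcc_of_le hpi]
      refine ContinuousOn.mul ((continuousOn_halfLineLaplace hint).comp (by fun_prop) ?_)
        (by fun_prop)
      rintro ζ ⟨h1, h2⟩
      rw [Set.mem_ofPred_eq, hre]
      exact mul_nonneg hlam0.le
        (mul_nonneg (Real.sinh_nonneg_iff.2 h1.1) (Real.cos_nonneg_of_mem_Icc h2)))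
    (by
      simp only [min_eq_left hR.le, min_eq_left hpi, max_eq_right hR.le, max_eq_right hpi]
      refine DifferentiableOn.mul ((differentiableOn_halfLineLaplace hint).comp (by fun_prop) ?_)
        (by fun_prop)
      rintro ζ ⟨h1, h2⟩
      rw [Set.mem_ofPred_eq, hre]
      exact mul_pos hlam0
        (mul_pos (Real.sinh_pos_iff.2 h1.1) (Real.cos_pos_of_mem_Ioo h2)))
  have hedges : ∀ x : ℝ, Φ (x + ((-(π / 2) : ℝ) : ℂ) * Complex.I)
      = Φ (x + ((π / 2 : ℝ) : ℂ) * Complex.I) := by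
    intro x
    have hS : Complex.sinh (x + ((π / 2 : ℝ) : ℂ) * Complex.I) = Real.cosh x * Complex.I := by
      rw [Complex.sinh_add, Complex.sinh_mul_I, Complex.cosh_mul_I]
      simp
    have hS' : Complex.sinh (x + ((-(π / 2) : ℝ) : ℂ) * Complex.I)
        = -(Real.cosh x * Complex.I) := by
      rw [Complex.sinh_add, Complex.sinh_mul_I, Complex.cosh_mul_I]
      simp
    have hn : Complex.sinh ((2 * l + 1 : ℕ) * (x + ((π / 2 : ℝ) : ℂ) * Complex.I))
        = -Complex.sinh ((2 * l + 1 : ℕ) * (x + ((-(π / 2) : ℝ) : ℂ) * Complex.I)) := by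
      have : ((2 * l + 1 : ℕ) : ℂ) * (x + ((π / 2 : ℝ) : ℂ) * Complex.I)
          = (2 * l + 1 : ℕ) * (x + ((-(π / 2) : ℝ) : ℂ) * Complex.I)
            + ((2 * l + 1 : ℕ) * π) * Complex.I := by
        push_cast; ring
      have hsin : Complex.sin ((2 * l + 1 : ℕ) * π) = 0 := Complex.sin_nat_mul_pi _
      have hcos : Complex.cos ((2 * l + 1 : ℕ) * π) = -1 := by
        have := Real.cos_nat_mul_pi (2 * l + 1)
        rw [(odd_two_mul_add_one l).neg_one_pow] at this
        exact_mod_cast congrArg Complex.ofReal this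
      rw [this, Complex.sinh_add, Complex.sinh_mul_I, Complex.cosh_mul_I, hsin, hcos]
      ring
    have hnorm : τ < ‖(lam : ℂ) * (Real.cosh x * Complex.I)‖ := by
      rw [norm_mul, norm_mul, Complex.norm_I, Complex.norm_real, Complex.norm_real, mul_one,
        norm_of_nonneg hlam0.le, norm_of_nonneg (Real.cosh_pos x).le]
      nlinarith [Real.one_le_cosh x]
    simp only [Φ]
    rw [hn, hS, hS', mul_neg,
      halfLineLaplace_neg_of_re_eq_zero hτ hgrowth hexp hint (by simp) hnorm]
    ring
  simp only [hedges, sub_self, zero_add, Complex.ofReal_zero, smul_eq_mul] at hrect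
  exact mul_left_cancel₀ Complex.I_ne_zero (sub_eq_zero.1 hrect)

/-- Fubini: the Hankel transform as an integral of the Laplace transform on the imaginary axis. -/
theorem integral_halfLineLaplace_sinh_eq_hankel {f : ℝ → ℂ} (hf : IntegrableOn f (Set.Ioi 0))
    (l : ℕ) (lam : ℝ) :
    ∫ θ in (-(π / 2))..(π / 2), halfLineLaplace f (lam * Complex.sinh (θ * Complex.I))
        * Complex.sinh ((2 * l + 1 : ℕ) * (θ * Complex.I))
      = π * ∫ x in Set.Ioi (0 : ℝ), f x * (besselJ (2 * l + 1) (lam * x) : ℂ) := by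
  have hker : Continuous fun p : ℝ × ℝ =>
      Complex.exp (-(lam * Complex.sinh (p.1 * Complex.I) * p.2))
        * Complex.sinh ((2 * l + 1 : ℕ) * (p.1 * Complex.I)) := by fun_prop
  have hker_le : ∀ p : ℝ × ℝ, ‖Complex.exp (-(lam * Complex.sinh (p.1 * Complex.I) * p.2))
        * Complex.sinh ((2 * l + 1 : ℕ) * (p.1 * Complex.I))‖ ≤ 1 := by
    intro p
    have h1 : ‖Complex.exp (-(lam * Complex.sinh (p.1 * Complex.I) * p.2))‖ = 1 := by
      rw [Complex.norm_exp, Real.exp_eq_one_iff, Complex.sinh_mul_I, ← Complex.ofReal_sin]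
      simp
    have h2 : ‖Complex.sinh ((2 * l + 1 : ℕ) * (p.1 * Complex.I))‖ ≤ 1 := by
      have : ((2 * l + 1 : ℕ) : ℂ) * (p.1 * Complex.I)
          = (((2 * l + 1 : ℕ) * p.1 : ℝ) : ℂ) * Complex.I := by push_cast; ring
      rw [this, Complex.sinh_mul_I, ← Complex.ofReal_sin, norm_mul, Complex.norm_I, mul_one,
        Complex.norm_real]
      exact Real.abs_sin_le_one _
    rw [norm_mul, h1, one_mul]
    exact h2
  have hprod : Integrable (Function.uncurry fun (θ x : ℝ) =>
      f x * (Complex.exp (-(lam * Complex.sinh (θ * Complex.I) * x))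
        * Complex.sinh ((2 * l + 1 : ℕ) * (θ * Complex.I))))
      ((volume.restrict (Set.uIoc (-(π / 2)) (π / 2))).prod (volume.restrict (Set.Ioi 0))) := by
    have h1 : Integrable (fun p : ℝ × ℝ => (1 : ℂ) * f p.2)
        ((volume.restrict (Set.uIoc (-(π / 2)) (π / 2))).prod (volume.restrict (Set.Ioi 0))) :=
      Integrable.mul_prod (f := fun _ : ℝ => (1 : ℂ))
        (by rw [Set.uIoc]; exact integrable_const _) hf
    simp only [one_mul] at h1
    refine Integrable.mono h1 (h1.aestronglyMeasurable.mul hker.aestronglyMeasurable)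
      (Filter.Eventually.of_forall fun p => ?_)
    simp only [Function.uncurry]
    rw [norm_mul]
    exact mul_le_of_le_one_right (norm_nonneg _) (hker_le p)
  have hswap := intervalIntegral_integral_swap hprod
  have hleft : ∀ θ : ℝ, halfLineLaplace f (lam * Complex.sinh (θ * Complex.I))
        * Complex.sinh ((2 * l + 1 : ℕ) * (θ * Complex.I))
      = ∫ x in Set.Ioi (0 : ℝ), f x * (Complex.exp (-(lam * Complex.sinh (θ * Complex.I) * x))
        * Complex.sinh ((2 * l + 1 : ℕ) * (θ * Complex.I))) := by
    intro θ
    rw [halfLineLaplace, ← integral_mul_const]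
    simp only [mul_assoc]
  simp only [hleft]
  rw [hswap, ← integral_const_mul]
  congr 1
  funext x
  rw [intervalIntegral.integral_const_mul]
  have := integral_exp_sinh_mul_sinh l (lam * x)
  rw [mul_left_comm, ← this]
  congr 1
  refine intervalIntegral.integral_congr fun θ _ => ?_
  push_cast
  ring_nf

theorem hankel_terminating_odd_order
    (τ : ℝ) (hτ : 0 ≤ τ) (m l : ℕ) (hl : m ≤ l)
    (h : ℂ → ℂ) (b : ℕ → ℂ) (hb : b 0 ≠ 0)
    (hh : ExpType τ h)
    (hexp : ∀ z : ℂ, HasSum (fun j : ℕ => b j * z ^ (2 * m + 2 * j)) (h z))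
    (hreal : ∀ x : ℝ, 0 ≤ x → (h x).im = 0)
    (hint : IntegrableOn (fun x : ℝ => h x) (Set.Ioi 0)) :
    ∀ lam : ℝ, τ < lam →
      ∫ x in Set.Ioi (0 : ℝ), h x * (besselJ (2 * l + 1) (lam * x) : ℂ)
        = (1 / 2) * ∑ j ∈ Finset.range (l - m + 1),
            b j * ((Nat.factorial (l + m + j) : ℂ) / (Nat.factorial (l - m - j) : ℂ))
              * (2 / (lam : ℂ)) ^ (2 * m + 2 * j + 1) := by
  intro lam hlam
  have hlam0 : 0 < lam := hτ.trans_lt hlam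
  have hR : 0 < Real.arsinh 1 := Real.arsinh_pos_iff.2 one_pos
  have hlamR : τ < lam * Real.sinh (Real.arsinh 1) := by rwa [Real.sinh_arsinh, mul_one]
  have hpi : (π : ℂ) ≠ 0 := by exact_mod_cast pi_ne_zero
  refine mul_left_cancel₀ hpi ?_
  rw [← integral_halfLineLaplace_sinh_mul_sinh hτ hl hh.2 hexp hint hlam0 hR hlamR,
    integral_halfLineLaplace_sinh_shift hτ l hh.2 hexp hint hlam hR,
    integral_halfLineLaplace_sinh_eq_hankel hint]
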